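/- arXiv:1810.02227 — 2 statements merged into one kernel-verified Lean document; each statement's English description precedes it below -/
import Mathlib

section
/- The minimum, taken over all initial activity patterns b_0 that are not identically false, of the total active-function count of the 6-round deterministic XOR trajectory starting from b_0, equals 6. -/
/-- The block shuffle of the 16-branch generalized Feistel network (Randen):
position `k` receives the branch previously at position `shuffle k`. -/
def shuffle : Fin 16 → Fin 16 :=
  ![7, 2, 13, 4, 11, 8, 3, 6, 15, 0, 9, 10, 1, 14, 5, 12]

/-- An activity pattern: `b k = true` means branch `k` carries a nonzero difference. -/
abbrev Pattern := Fin 16 → Bool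

/-- The even branch `b (2 i)` feeding round function `i`. -/
def evenBr (b : Pattern) (i : Fin 8) : Bool := b ⟨2 * i.val, by have := i.isLt; omega⟩

/-- The odd branch `b (2 i + 1)` receiving the output of round function `i`. -/
def oddBr (b : Pattern) (i : Fin 8) : Bool := b ⟨2 * i.val + 1, by have := i.isLt; omega⟩

/-- The intermediate pattern `c` with `c (2 i) = b (2 i)` and `c (2 i + 1) = t i`. -/
def combine (b : Pattern) (t : Fin 8 → Bool) : Pattern := fun k =>
  if k.val % 2 = 0 then b k else t ⟨k.val / 2, by have := k.isLt; omega⟩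

/-- One round of truncated-differential propagation: `b` transforms into `b'` iff
there is `t : Fin 8 → Bool` with `t i = false` whenever both inputs of round
function `i` are inactive, `t i = true` whenever exactly one input is active
(`t i` is unconstrained if both inputs are active, since differences may cancel),
and `b' k = c (shuffle k)` where `c (2 i) = b (2 i)`, `c (2 i + 1) = t i`. -/
def Step (b b' : Pattern) : Prop :=
  ∃ t : Fin 8 → Bool,
    (∀ i : Fin 8,
      ((evenBr b i = false ∧ oddBr b i = false) → t i = false) ∧
      (xor (evenBr b i) (oddBr b i) = true → t i = true)) ∧
    (∀ k : Fin 16, b' k = combine b t (shuffle k))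

/-- Number of active functions of a pattern: the number of `i : Fin 8` with
`b (2 i) = true`. -/
def activeFuncs (b : Pattern) : ℕ :=
  (Finset.univ.filter fun i : Fin 8 => evenBr b i = true).card

/-- A valid `r`-round trajectory: each `b (j + 1)` arises from `b j` by one round. -/
def ValidTraj (r : ℕ) (b : ℕ → Pattern) : Prop :=
  ∀ j < r, Step (b j) (b (j + 1))

/-- Total active-function count of an `r`-round trajectory. -/
def totalActive (r : ℕ) (b : ℕ → Pattern) : ℕ :=
  ∑ j ∈ Finset.range r, activeFuncs (b j)

/-- One round of the deterministic XOR resolution: `t i = xor (b (2 i)) (b (2 i + 1))`. -/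
def xorStep (b : Pattern) : Pattern := fun k =>
  combine b (fun i => xor (evenBr b i) (oddBr b i)) (shuffle k)

/-- Position `i` of the even branches is fed by the round function `evenSource i`. -/
def evenSource : Fin 8 → Fin 8 := ![3, 6, 5, 1, 7, 4, 0, 2]

/-- Position `i` of the odd branches is fed by the even branch `oddSource i`. -/
def oddSource : Fin 8 → Fin 8 := ![1, 2, 4, 3, 0, 5, 7, 6]

/-- The inverse of `oddSource ∘ evenSource`. -/
def sourceInv : Fin 8 → Fin 8 := ![5, 6, 3, 0, 7, 2, 4, 1]

/-- The even branches of a round, given those of the two preceding rounds, the older first. -/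
def nextEven (x y : Fin 8 → Bool) : Fin 8 → Bool := fun i =>
  xor (y (evenSource i)) (x (oddSource (evenSource i)))

/-- The even branches of a round, given those of the two following rounds, the later first. -/
def prevEven (z y : Fin 8 → Bool) : Fin 8 → Bool := fun i =>
  xor (z (sourceInv i)) (y (evenSource (sourceInv i)))

/-- The number of active positions, as a sum that evaluates quickly. -/
def weight (x : Fin 8 → Bool) : ℕ :=
  (x 0).toNat + (x 1).toNat + (x 2).toNat + (x 3).toNat + (x 4).toNat + (x 5).toNat +
    (x 6).toNat + (x 7).toNat

/-- The total weight of the `n` terms starting with `y` of the sequence `x, y, f x y, …`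
generated by the two-term recurrence `f`. -/
def recWeight (f : (Fin 8 → Bool) → (Fin 8 → Bool) → Fin 8 → Bool) :
    ℕ → (Fin 8 → Bool) → (Fin 8 → Bool) → ℕ
  | 0, _, _ => 0
  | n + 1, x, y => weight y + recWeight f n y (f x y)

theorem activeFuncs_eq_weight (b : Pattern) : activeFuncs b = weight (evenBr b) := by
  simp only [activeFuncs, weight, Finset.card_filter, Fin.sum_univ_eight, Bool.toNat,
    Bool.cond_eq_ite]

theorem evenBr_xorStep (b : Pattern) (i : Fin 8) :
    evenBr (xorStep b) i = xor (evenBr b (evenSource i)) (oddBr b (evenSource i)) := by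
  fin_cases i <;> rfl

theorem oddBr_xorStep (b : Pattern) (i : Fin 8) :
    oddBr (xorStep b) i = evenBr b (oddSource i) := by
  fin_cases i <;> rfl

theorem evenBr_xorStep_xorStep (b : Pattern) :
    evenBr (xorStep (xorStep b)) = nextEven (evenBr b) (evenBr (xorStep b)) := by
  funext i
  rw [evenBr_xorStep, oddBr_xorStep, nextEven]

theorem prevEven_nextEven (x y : Fin 8 → Bool) : prevEven (nextEven x y) y = x := by
  have h : ∀ i, oddSource (evenSource (sourceInv i)) = i := by decide
  funext i
  simp only [prevEven, nextEven, h]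
  cases y (evenSource (sourceInv i)) <;> cases x i <;> rfl

theorem weight_eq_zero_iff (x : Fin 8 → Bool) : weight x = 0 ↔ x = fun _ => false := by
  simp [weight, funext_iff, Fin.forall_fin_succ, and_assoc]

theorem recWeight_nextEven {e : ℕ → Fin 8 → Bool}
    (he : ∀ j, e (j + 2) = nextEven (e j) (e (j + 1))) (n j : ℕ) :
    recWeight nextEven n (e j) (e (j + 1)) = ∑ i ∈ Finset.range n, weight (e (j + 1 + i)) := by
  induction n generalizing j with
  | zero => rfl
  | succ n ih =>
    rw [recWeight, ← he, ih, Finset.sum_range_succ', add_comm]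
    simp only [add_zero, add_assoc, add_comm 1]

theorem recWeight_prevEven {e : ℕ → Fin 8 → Bool}
    (he : ∀ j, prevEven (e (j + 2)) (e (j + 1)) = e j) (n : ℕ) :
    recWeight prevEven n (e n) (prevEven (e (n + 1)) (e n)) =
      ∑ i ∈ Finset.range n, weight (e i) := by
  induction n with
  | zero => rfl
  | succ n ih => rw [recWeight, he, ih, Finset.sum_range_succ, add_comm]

/-- A pattern vanishes once the even branches of its first two rounds do. -/
theorem eq_false_of_evenBr_eq_false {b : Pattern} (h0 : evenBr b = fun _ => false)
    (h1 : evenBr (xorStep b) = fun _ => false) (k : Fin 16) : b k = false := by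
  have hodd (i : Fin 8) : oddBr b i = false := by
    have hsurj : ∀ i, ∃ m, evenSource m = i := by decide
    obtain ⟨m, rfl⟩ := hsurj i
    simpa [h0] using (evenBr_xorStep b m).symm.trans (congrFun h1 m)
  have heven (i : Fin 8) : evenBr b i = false := congrFun h0 i
  obtain hk | hk := Nat.mod_two_eq_zero_or_one k.val
  · rw [← heven ⟨k.val / 2, by omega⟩, evenBr]
    congr 1
    ext
    simp only
    omega
  · rw [← hodd ⟨k.val / 2, by omega⟩, oddBr]
    congr 1
    ext
    simp only
    omega

/-- Six consecutive rounds, the `j`-th of which has no active function. -/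
theorem six_le_recWeight_add_recWeight : ∀ w : Fin 8 → Bool, w ≠ (fun _ => false) →
    ∀ j : Fin 6, 6 ≤ recWeight prevEven j (fun _ => false) (prevEven w fun _ => false) +
      recWeight nextEven (5 - j) (fun _ => false) w := by
  decide +kernel

/-- A sequence obeying the two-term recurrence that does not start with two zero terms has total
weight at least six over its first six terms. -/
theorem six_le_sum_weight {e : ℕ → Fin 8 → Bool}
    (he : ∀ j, e (j + 2) = nextEven (e j) (e (j + 1)))
    (h01 : ¬ (e 0 = (fun _ => false) ∧ e 1 = fun _ => false)) :
    6 ≤ ∑ j ∈ Finset.range 6, weight (e j) := by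
  have hprev (j : ℕ) : prevEven (e (j + 2)) (e (j + 1)) = e j := by
    rw [he, prevEven_nextEven]
  have hne (j : ℕ) : ¬ (e j = (fun _ => false) ∧ e (j + 1) = fun _ => false) := by
    induction j with
    | zero => exact h01
    | succ j ih =>
      rintro ⟨h1, h2⟩
      refine ih ⟨?_, h1⟩
      rw [← hprev, h1, h2]
      rfl
  by_cases hpos : ∀ j ∈ Finset.range 6, 1 ≤ weight (e j)
  · simpa using Finset.card_nsmul_le_sum _ _ 1 hpos
  push Not at hpos
  obtain ⟨j, hj, hlt⟩ := hpos
  have hj6 : j < 6 := Finset.mem_range.mp hj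
  have hzero : e j = fun _ => false := (weight_eq_zero_iff _).mp (by omega)
  have key := six_le_recWeight_add_recWeight (e (j + 1)) (fun h => hne j ⟨hzero, h⟩) ⟨j, hj6⟩
  simp only [← hzero] at key
  rw [recWeight_prevEven hprev, recWeight_nextEven he] at key
  have hsplit := Finset.sum_range_add (fun i => weight (e i)) (j + 1) (5 - j)
  rw [show j + 1 + (5 - j) = 6 by omega, Finset.sum_range_succ _ j] at hsplit
  omega

theorem xor_trajectory_six_rounds_min_eq_six :
    IsLeast {n : ℕ | ∃ b0 : Pattern, (∃ k, b0 k = true) ∧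
      totalActive 6 (fun j => xorStep^[j] b0) = n} 6 := by
  refine ⟨⟨fun k => decide (k = 0 ∨ k = 1 ∨ k = 15), ⟨0, rfl⟩, by decide +kernel⟩, ?_⟩
  rintro n ⟨b, ⟨k, hk⟩, rfl⟩
  simp only [totalActive, activeFuncs_eq_weight]
  refine six_le_sum_weight (e := fun j => evenBr (xorStep^[j] b)) (fun j => ?_) ?_
  · simp only [Function.iterate_succ_apply', evenBr_xorStep_xorStep]
  · rintro ⟨h0, h1⟩
    exact Bool.false_ne_true ((eq_false_of_evenBr_eq_false h0 h1 k).symm.trans hk)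
end

section
/- Every valid 17-round trajectory of activity patterns whose initial pattern is not identically false has total active-function count at least 36; consequently, any natural number S with S ≥ 5 · (total active-function count) satisfies S ≥ 180. -/
/-! Sets of pairs (pattern, remaining budget) are stored as natural numbers: the pair `(x, c)` is
the bit with index `2 ^ 16 * c + Nat.ofBits x`. The shuffle is never carried out on these sets;
round `j` instead acts on the positions `shuffle^[j] k`. -/

/-- A number whose bits below `2 ^ q` are those indexed by the `n` with `n.testBit p = v`. -/
def bitMask (p : ℕ) (v : Bool) : ℕ → ℕ
  | 0 => (!v).toNat
  | q + 1 => bitMask p v q |||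
      (if q = p then (if v then 2 ^ 2 ^ q - 1 else 0) else bitMask p v q) <<< 2 ^ q

theorem testBit_bitMask {p : ℕ} {v : Bool} {q n : ℕ} (hn : n < 2 ^ q) (h : n.testBit p = v) :
    (bitMask p v q).testBit n = true := by
  induction q generalizing n with
  | zero =>
    obtain rfl : n = 0 := by simpa using hn
    simp only [Nat.zero_testBit] at h
    subst h
    simp [bitMask]
  | succ q ih =>
    rw [bitMask, Nat.testBit_or, Bool.or_eq_true]
    rcases lt_or_ge n (2 ^ q) with hlt | hge
    · exact Or.inl (ih hlt h)
    · right
      obtain ⟨m, rfl⟩ := Nat.exists_eq_add_of_le hge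
      have hm : m < 2 ^ q := by rw [pow_succ] at hn; omega
      rw [Nat.testBit_shiftLeft, Nat.add_sub_cancel_left]
      have hbit : (2 ^ q + m).testBit p = if q = p then true else m.testBit p := by
        have := Nat.testBit_two_pow_mul_add 1 hm p
        rw [mul_one] at this
        rw [this]
        split_ifs with h₁ h₂ h₂
        · omega
        · rfl
        · rw [h₂, Nat.sub_self]; rfl
        · rw [Nat.testBit_lt_two_pow (hm.trans_le (Nat.pow_le_pow_right two_pos (by omega))),
            ← pow_zero 2, Nat.testBit_two_pow_of_ne (by omega)]
      rw [hbit] at h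
      rw [decide_eq_true (Nat.le_add_right _ m), Bool.true_and]
      by_cases hqp : q = p
      · rw [if_pos hqp] at h ⊢
        rw [if_pos h.symm, Nat.testBit_two_pow_sub_one, decide_eq_true hm]
      · rw [if_neg hqp] at h ⊢
        exact ih hm h

/-- `f n`, arranged so that the kernel evaluates `n` to a literal before substituting it. -/
def evalArg (n : ℕ) (f : ℕ → ℕ) : ℕ :=
  match n with
  | 0 => f 0
  | m + 1 => f (m + 1)

theorem evalArg_eq (n : ℕ) (f : ℕ → ℕ) : evalArg n f = f n := by
  cases n <;> rfl

/-- Action of one round function from position `u` to position `v` on a set of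
budgeted patterns. -/
def applyFunc (u v S : ℕ) : ℕ :=
  let T := (S &&& bitMask u true 22) >>> 2 ^ 16
  let T₁ := T &&& bitMask v true 22
  (S &&& bitMask u false 22) ||| (T &&& bitMask v false 22) <<< 2 ^ v ||| T₁ ||| T₁ >>> 2 ^ v

/-- The even branch of round function `i`. -/
def evenIdx (i : Fin 8) : Fin 16 := ⟨2 * i.val, by have := i.isLt; omega⟩

/-- The odd branch of round function `i`. -/
def oddIdx (i : Fin 8) : Fin 16 := ⟨2 * i.val + 1, by have := i.isLt; omega⟩

/-- Action of the round functions listed in `l` on a set of budgeted patterns, with branch `k`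
stored at position `p k`. -/
def applyFuncs (p : Fin 16 → Fin 16) (l : List (Fin 8)) (S : ℕ) : ℕ :=
  l.foldl (fun S i =>
    evalArg (p (evenIdx i)) fun u => evalArg (p (oddIdx i)) fun v => applyFunc u v S) S

/-- The set of all nonzero `w`-bit patterns with budget `c`. -/
def nonzeroPatterns (w c : ℕ) : ℕ := (2 ^ (2 ^ w - 1) - 1) <<< (2 ^ w * c + 1)

theorem testBit_nonzeroPatterns {w c n : ℕ} (hn : n ≠ 0) (hw : n < 2 ^ w) :
    (nonzeroPatterns w c).testBit (2 ^ w * c + n) = true := by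
  rw [nonzeroPatterns, Nat.testBit_shiftLeft, Nat.testBit_two_pow_sub_one, Bool.and_eq_true,
    decide_eq_true_eq, decide_eq_true_eq]
  omega

/-- The budgeted patterns that are reachable after `r` rounds from a nonzero pattern with
budget 35. -/
def reachable : ℕ → ℕ
  | 0 => nonzeroPatterns 16 35
  | r + 1 => applyFuncs (shuffle^[r]) (List.finRange 8) (reachable r)

theorem reachable_seventeen : reachable 17 = 0 := by
  decide +kernel

theorem ofBits_update {n : ℕ} (f : Fin n → Bool) (k : Fin n) (v : Bool) :
    Nat.ofBits (Function.update f k v) + (f k).toNat * 2 ^ k.val =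
      Nat.ofBits f + v.toNat * 2 ^ k.val := by
  induction n with
  | zero => exact k.elim0
  | succ n ih =>
    rw [Nat.ofBits_succ, Nat.ofBits_succ f]
    cases k using Fin.cases with
    | zero =>
      have : Function.update f 0 v ∘ Fin.succ = f ∘ Fin.succ := by
        ext i; simp
      rw [this]
      simp
      omega
    | succ k =>
      have : Function.update f k.succ v ∘ Fin.succ = Function.update (f ∘ Fin.succ) k v :=
        Function.update_comp_eq_of_injective f (Fin.succ_injective n) k v
      have h := ih (f ∘ Fin.succ) k
      rw [this, Function.update_of_ne (Fin.succ_ne_zero k).symm]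
      simp only [Function.comp_apply, Fin.val_succ, pow_succ] at h ⊢
      linarith

/-- The set `S` contains the pattern `x` with remaining budget `c`. -/
def Contains (S : ℕ) (x : Pattern) (c : ℕ) : Prop :=
  S.testBit (2 ^ 16 * c + Nat.ofBits x) = true

theorem testBit_index (x : Pattern) (c : ℕ) (k : Fin 16) :
    (2 ^ 16 * c + Nat.ofBits x).testBit k = x k := by
  rw [Nat.testBit_two_pow_mul_add _ (Nat.ofBits_lt_two_pow x), if_pos k.isLt,
    Nat.testBit_ofBits_lt _ _ k.isLt]

theorem Contains.and_bitMask {S : ℕ} {x : Pattern} {c : ℕ} (h : Contains S x c) (hc : c < 64)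
    (k : Fin 16) : Contains (S &&& bitMask k (x k) 22) x c := by
  have hx := Nat.ofBits_lt_two_pow x
  rw [Contains, Nat.testBit_and, h, testBit_bitMask (by omega) (testBit_index x c k)]
  rfl

theorem Contains.applyFunc {S : ℕ} {x : Pattern} {c : ℕ} {u v : Fin 16} {t : Bool} (hc : c < 64)
    (h : Contains S x (c + (x u).toNat)) (hcost : c + (x u).toNat < 64)
    (hzero : x u = false → t = x v) (hone : x u = true → x v = false → t = true) :
    Contains (applyFunc u v S) (Function.update x v t) c := by
  have hu := h.and_bitMask hcost u
  have hupd := ofBits_update x v t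
  simp only [_root_.applyFunc, Contains, Nat.testBit_or, Bool.or_eq_true]
  cases hxu : x u with
  | false =>
    rw [hzero hxu, Function.update_eq_self]
    simp only [hxu, Bool.toNat_false, add_zero] at hu
    exact Or.inl (Or.inl (Or.inl hu))
  | true =>
    have hT : Contains ((S &&& bitMask u true 22) >>> 2 ^ 16) x c := by
      simp only [hxu, Contains, Bool.toNat_true] at hu
      rwa [Contains, Nat.testBit_shiftRight,
        show 2 ^ 16 + (2 ^ 16 * c + Nat.ofBits x) = 2 ^ 16 * (c + 1) + Nat.ofBits x by ring]
    have hv := hT.and_bitMask hc v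
    cases hxv : x v with
    | false =>
      rw [hxv] at hv hupd
      rw [hone hxu hxv] at hupd ⊢
      simp only [Bool.toNat_false, Bool.toNat_true, zero_mul, add_zero, one_mul] at hupd
      refine Or.inl (Or.inl (Or.inr ?_))
      rw [hupd, ← add_assoc, Nat.testBit_shiftLeft, Nat.add_sub_cancel, Bool.and_eq_true]
      exact ⟨decide_eq_true (Nat.le_add_left _ _), hv⟩
    | true =>
      rw [hxv] at hv hupd
      cases t with
      | true =>
        rw [← hxv, Function.update_eq_self, hxv]
        exact Or.inl (Or.inr hv)
      | false =>
        right
        simp only [Bool.toNat_false, Bool.toNat_true, zero_mul, add_zero, one_mul] at hupd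
        rw [Nat.testBit_shiftRight]
        rw [Contains, ← hupd] at hv
        rwa [add_comm (2 ^ v.val), add_assoc]

theorem oddIdx_injective : Function.Injective oddIdx := by decide

theorem evenIdx_ne_oddIdx : ∀ i j, evenIdx i ≠ oddIdx j := by decide

theorem shuffle_injective : Function.Injective shuffle := by decide

theorem Contains.applyFuncs {p : Fin 16 → Fin 16} (hp : Function.Injective p) {b : Pattern}
    {t : Fin 8 → Bool} (ht : ∀ i, ((evenBr b i = false ∧ oddBr b i = false) → t i = false) ∧
      (xor (evenBr b i) (oddBr b i) = true → t i = true))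
    {l : List (Fin 8)} (hl : l.Nodup) {S : ℕ} {x : Pattern} {c : ℕ}
    (heven : ∀ i ∈ l, x (p (evenIdx i)) = evenBr b i)
    (hodd : ∀ i ∈ l, x (p (oddIdx i)) = oddBr b i)
    (hcost : c + (l.map fun i => (evenBr b i).toNat).sum < 64)
    (h : Contains S x (c + (l.map fun i => (evenBr b i).toNat).sum)) :
    ∃ y, Contains (applyFuncs p l S) y c ∧ (∀ i ∈ l, y (p (oddIdx i)) = t i) ∧
      ∀ k, (∀ i ∈ l, k ≠ p (oddIdx i)) → y k = x k := by
  induction l generalizing S x with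
  | nil => exact ⟨x, by simpa [_root_.applyFuncs] using h, by simp, by simp⟩
  | cons i l ih =>
    obtain ⟨hil, hl⟩ := List.nodup_cons.mp hl
    simp only [List.map_cons, List.sum_cons] at h hcost
    have hxe := heven i List.mem_cons_self
    have hxo := hodd i List.mem_cons_self
    have hne : ∀ j ∈ l, p (oddIdx j) ≠ p (oddIdx i) := fun j hj hji =>
      hil (oddIdx_injective (hp hji) ▸ hj)
    have hstep := Contains.applyFunc (u := p (evenIdx i)) (v := p (oddIdx i)) (t := t i)
      (S := S) (x := x) (c := c + (l.map fun i => (evenBr b i).toNat).sum) (by omega)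
      (by rw [hxe]; convert h using 1; ring) (by rw [hxe]; omega)
      (by
        rw [hxe, hxo]; intro he
        have := ht i
        cases ho : oddBr b i <;> simp_all)
      (by
        rw [hxe, hxo]; intro he ho
        exact (ht i).2 (by simp [he, ho]))
    obtain ⟨y, hy, hyodd, hyrest⟩ := ih hl
      (fun j hj => by
        rw [Function.update_of_ne fun e => evenIdx_ne_oddIdx j i (hp e)]
        exact heven j (List.mem_cons_of_mem _ hj))
      (fun j hj => by
        rw [Function.update_of_ne (hne j hj)]
        exact hodd j (List.mem_cons_of_mem _ hj))
      (by omega) hstep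
    refine ⟨y, ?_, ?_, ?_⟩
    · simpa only [_root_.applyFuncs, List.foldl_cons, evalArg_eq] using hy
    · intro j hj
      rcases List.mem_cons.mp hj with rfl | hj
      · rw [hyrest _ fun k hk => (hne k hk).symm, Function.update_self]
      · exact hyodd j hj
    · intro k hk
      rw [hyrest k fun j hj => hk j (List.mem_cons_of_mem _ hj),
        Function.update_of_ne (hk i List.mem_cons_self)]

theorem activeFuncs_eq_sum (b : Pattern) :
    activeFuncs b = ((List.finRange 8).map fun i => (evenBr b i).toNat).sum := by
  rw [activeFuncs, Finset.card_filter, ← Fin.sum_univ_def]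
  exact Finset.sum_congr rfl fun i _ => by cases evenBr b i <;> rfl

theorem combine_evenIdx (b : Pattern) (t : Fin 8 → Bool) (i : Fin 8) :
    combine b t (evenIdx i) = evenBr b i := by
  simp [combine, evenIdx, evenBr]

theorem combine_oddIdx (b : Pattern) (t : Fin 8 → Bool) (i : Fin 8) :
    combine b t (oddIdx i) = t i := by
  have h : (2 * i.val + 1) / 2 = i.val := by omega
  simp [combine, oddIdx, h]

theorem exists_eq_evenIdx_or_oddIdx : ∀ k : Fin 16, ∃ i, k = evenIdx i ∨ k = oddIdx i := by
  decide

theorem contains_reachable_succ {r c : ℕ} {b b' : Pattern} (hstep : Step b b') {x : Pattern}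
    (hx : ∀ k, x (shuffle^[r] k) = b k) (hcost : c + activeFuncs b < 64)
    (h : Contains (reachable r) x (c + activeFuncs b)) :
    ∃ y, (∀ k, y (shuffle^[r + 1] k) = b' k) ∧ Contains (reachable (r + 1)) y c := by
  obtain ⟨t, ht, hb'⟩ := hstep
  have hp : Function.Injective shuffle^[r] := shuffle_injective.iterate r
  rw [activeFuncs_eq_sum] at h hcost
  obtain ⟨y, hy, hyodd, hyrest⟩ := Contains.applyFuncs hp ht (List.nodup_finRange 8)
    (fun i _ => hx (evenIdx i)) (fun i _ => hx (oddIdx i)) hcost h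
  refine ⟨y, fun k => ?_, hy⟩
  rw [Function.iterate_succ_apply, hb' k]
  obtain ⟨i, hi | hi⟩ := exists_eq_evenIdx_or_oddIdx (shuffle k)
  · rw [hi, combine_evenIdx, hyrest _ fun j _ e => evenIdx_ne_oddIdx i j (hp e)]
    exact hx (evenIdx i)
  · rw [hi, combine_oddIdx, hyodd i (List.mem_finRange i)]

theorem contains_reachable_zero {x : Pattern} (hx : ∃ k, x k = true) :
    Contains (reachable 0) x 35 := by
  obtain ⟨k, hk⟩ := hx
  have hlt := Nat.ofBits_lt_two_pow x
  have hpos : Nat.ofBits x ≠ 0 := fun h0 => by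
    have := Nat.testBit_ofBits_lt x k k.isLt
    rw [h0, Nat.zero_testBit, Fin.eta, hk] at this
    exact Bool.false_ne_true this
  exact testBit_nonzeroPatterns hpos hlt

theorem exists_contains_reachable {b : ℕ → Pattern} {r c : ℕ} (hb : ValidTraj r b)
    (h0 : ∃ k, b 0 k = true) (hc : c + totalActive r b = 35) :
    ∃ x, (∀ k, x (shuffle^[r] k) = b r k) ∧ Contains (reachable r) x c := by
  induction r generalizing c with
  | zero =>
    obtain rfl : c = 35 := by simpa [totalActive] using hc
    exact ⟨b 0, fun _ => rfl, contains_reachable_zero h0⟩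
  | succ r ih =>
    rw [totalActive, Finset.sum_range_succ, ← totalActive] at hc
    obtain ⟨x, hx, hS⟩ := ih (c := c + activeFuncs (b r))
      (fun j hj => hb j (hj.trans r.lt_succ_self)) (by omega)
    exact contains_reachable_succ (hb r r.lt_succ_self) hx (by omega) hS

theorem seventeen_rounds_active_bound :
    ∀ b : ℕ → Pattern, ValidTraj 17 b → (∃ k, b 0 k = true) →
      36 ≤ totalActive 17 b ∧
        ∀ S : ℕ, 5 * totalActive 17 b ≤ S → 180 ≤ S := by
  intro b hb h0
  have hbound : 36 ≤ totalActive 17 b := by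
    by_contra! hlt
    obtain ⟨x, -, hx⟩ := exists_contains_reachable (c := 35 - totalActive 17 b) hb h0 (by omega)
    rw [Contains, reachable_seventeen, Nat.zero_testBit] at hx
    exact Bool.false_ne_true hx
  exact ⟨hbound, fun S hS => by omega⟩
end
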